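/- arXiv:1505.07666 — 2 statements merged into one kernel-verified Lean document; each statement's English description precedes it below -/
import Mathlib

section
/- Let α_m, α_f be real numbers with α_f ≠ 1 and 1 − α_m + α_f ≠ 0, and set γ = 1/2 − α_m + α_f and β = (1/4)(1 − α_m + α_f)². Let A_∞ be the 3×3 real matrix with rows [α_f/(α_f − 1), 0, 0], [−γ/((1 − α_f)β), −(γ − β)/β, −(γ/2 − β)/β], [−1/((1 − α_f)β), −1/β, −(1/2 − β)/β]. Then 16β − (2γ + 1)² = 0 and the characteristic polynomial of A_∞ equals (X − α_f/(α_f − 1))·(X − (α_f − α_m − 1)/(α_f − α_m + 1))²; i.e., the principal high-frequency eigenvalues coalesce into the real double eigenvalue λ_{1,2}^∞ = (α_f − α_m − 1)/(α_f − α_m + 1). -/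
open Polynomial

/-- The characteristic polynomial of a `3 × 3` matrix that is block lower triangular with blocks
of sizes `1` and `2`. -/
theorem charpoly_fin_three_of_blockLowerTriangular {R : Type*} [CommRing R]
    (a b c d e f g : R) :
    (!![a, 0, 0; b, c, d; e, f, g] : Matrix (Fin 3) (Fin 3) R).charpoly =
      (X - C a) * (X ^ 2 - C (c + g) * X + C (c * g - d * f)) := by
  simp [Matrix.charpoly, Matrix.det_fin_three]
  ring

/-- With the second-order choice `γ = 1/2 − αm + αf` and the maximal
high-frequency dissipation choice `β = (1/4)(1 − αm + αf)²`, the discriminant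
`16β − (2γ+1)²` vanishes and the principal high-frequency eigenvalues of `A_∞`
coalesce into the real double eigenvalue `(αf − αm − 1)/(αf − αm + 1)`. -/
theorem genAlpha_Ainf_double_eigenvalue
    (αm αf : ℝ) (hαf : αf ≠ 1) (hne : 1 - αm + αf ≠ 0)
    (γ β : ℝ)
    (hγ : γ = 1 / 2 - αm + αf)
    (hβ : β = (1 / 4) * (1 - αm + αf) ^ 2)
    (Ainf : Matrix (Fin 3) (Fin 3) ℝ)
    (hAinf : Ainf =
      !![αf / (αf - 1), 0, 0;
         -(γ / ((1 - αf) * β)), -((γ - β) / β), -((γ / 2 - β) / β);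
         -(1 / ((1 - αf) * β)), -(1 / β), -((1 / 2 - β) / β)]) :
    16 * β - (2 * γ + 1) ^ 2 = 0 ∧
    Ainf.charpoly =
      (X - C (αf / (αf - 1))) * (X - C ((αf - αm - 1) / (αf - αm + 1))) ^ 2 := by
  refine ⟨by subst hγ hβ; ring, ?_⟩
  have hne' : αf - αm + 1 ≠ 0 := by convert hne using 1; ring
  set r := (αf - αm - 1) / (αf - αm + 1) with hr
  have hβ0 : β ≠ 0 := by rw [hβ]; positivity
  have htrace : -((γ - β) / β) + -((1 / 2 - β) / β) = 2 * r := by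
    rw [hr]
    field_simp
    rw [hγ, hβ]
    ring
  have hdet : -((γ - β) / β) * -((1 / 2 - β) / β) - -((γ / 2 - β) / β) * -(1 / β) = r ^ 2 := by
    rw [hr]
    field_simp
    rw [hγ, hβ]
    ring
  rw [hAinf, charpoly_fin_three_of_blockLowerTriangular, htrace, hdet]
  simp only [C_mul, C_pow, C_ofNat]
  ring
end

section
/- Let ρ ∈ [0, 1] be a real number and set α_m = (2ρ − 1)/(ρ + 1), α_f = ρ/(ρ + 1), γ = 1/2 − α_m + α_f, β = (1/4)(1 − α_m + α_f)². Let A_∞ be the 3×3 real matrix with rows [α_f/(α_f − 1), 0, 0], [−γ/((1 − α_f)β), −(γ − β)/β, −(γ/2 − β)/β], [−1/((1 − α_f)β), −1/β, −(1/2 − β)/β]. Then α_f = (α_m + 1)/3 and the characteristic polynomial of A_∞ equals (X + ρ)³; in particular, every eigenvalue of A_∞ equals −ρ, so the spectral radius of the amplification matrix in the high-frequency limit equals ρ. -/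
open Polynomial

/-- The characteristic polynomial of a `3 × 3` matrix whose first row is `(a, 0, 0)`. -/
theorem charpoly_fin_three_of_first_row {R : Type*} [CommRing R] (a b p q c r s : R) :
    (!![a, 0, 0; b, p, q; c, r, s] : Matrix (Fin 3) (Fin 3) R).charpoly =
      (X - C a) * (X ^ 2 - C (p + s) * X + C (p * s - q * r)) := by
  simp [Matrix.charpoly, Matrix.det_fin_three]
  ring

/-- For the optimal generalized-α parameters associated with a prescribed
high-frequency spectral radius `ρ ∈ [0,1]`, we have `αf = (αm + 1)/3`, the
characteristic polynomial of the high-frequency limit matrix `A_∞` is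
`(X + ρ)³`, and every complex eigenvalue of `A_∞` equals `−ρ`. -/
theorem genAlpha_optimal_spectral_radius
    (ρ : ℝ) (hρ0 : 0 ≤ ρ) (hρ1 : ρ ≤ 1)
    (αm αf γ β : ℝ)
    (hαm : αm = (2 * ρ - 1) / (ρ + 1))
    (hαf : αf = ρ / (ρ + 1))
    (hγ : γ = 1 / 2 - αm + αf)
    (hβ : β = (1 / 4) * (1 - αm + αf) ^ 2)
    (Ainf : Matrix (Fin 3) (Fin 3) ℝ)
    (hAinf : Ainf =
      !![αf / (αf - 1), 0, 0;
         -(γ / ((1 - αf) * β)), -((γ - β) / β), -((γ / 2 - β) / β);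
         -(1 / ((1 - αf) * β)), -(1 / β), -((1 / 2 - β) / β)]) :
    αf = (αm + 1) / 3 ∧
    Ainf.charpoly = (X + C ρ) ^ 3 ∧
    (∀ lam : ℂ, (Ainf.map Complex.ofReal).charpoly.eval lam = 0 → lam = -(ρ : ℂ)) := by
  have hρ : ρ + 1 ≠ 0 := by positivity
  have hβ' : β = 1 / (ρ + 1) ^ 2 := by
    rw [hβ, hαm, hαf]; field_simp; ring
  have hγ' : γ = (3 - ρ) / (2 * (ρ + 1)) := by
    rw [hγ, hαm, hαf]; field_simp; ring
  have ha : αf / (αf - 1) = -ρ := by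
    have h : αf - 1 = -(1 / (ρ + 1)) := by rw [hαf]; field_simp; ring
    rw [h, hαf]; field_simp
  have htr : -((γ - β) / β) + -((1 / 2 - β) / β) = -(2 * ρ) := by
    rw [hβ', hγ']; field_simp; ring
  have hdet : -((γ - β) / β) * -((1 / 2 - β) / β) - -((γ / 2 - β) / β) * -(1 / β) = ρ ^ 2 := by
    rw [hβ', hγ']; field_simp; ring
  have hchar : Ainf.charpoly = (X + C ρ) ^ 3 := by
    rw [hAinf, charpoly_fin_three_of_first_row, ha, htr, hdet]
    simp only [map_neg, map_mul, map_pow, map_ofNat]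
    ring
  refine ⟨by rw [hαm, hαf]; field_simp; ring, hchar, fun lam hlam => ?_⟩
  have hmap : (Ainf.map Complex.ofReal).charpoly = (X + C (ρ : ℂ)) ^ 3 := by
    have h := Matrix.charpoly_map Ainf Complex.ofRealHom
    rw [hchar] at h
    simp only [Polynomial.map_pow, Polynomial.map_add, map_X, map_C] at h
    exact h
  rw [hmap] at hlam
  simp only [eval_pow, eval_add, eval_X, eval_C] at hlam
  exact eq_neg_of_add_eq_zero_left (pow_eq_zero_iff (by norm_num) |>.mp hlam)
end
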